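/- arXiv:2103.11060 — 2 statements merged into one kernel-verified Lean document; each statement's English description precedes it below -/
import Mathlib

section
/- Let U ⊆ ℝ^n be open, a > 0, let f₁, f₂ : U × (−a,a) → ℝ^m be smooth (C^∞), and let r ≥ 1 be a natural number. The following are equivalent: (i) there exists a continuous function δf : U × (−a,a) → ℝ^m with f₂(x,h) − f₁(x,h) = h^r · δf(x,h) for all (x,h); (ii) for every x₀ ∈ U there exist an open set U′ ⊆ U containing x₀, a constant a′ ∈ (0,a], and a constant C ≥ 0 such that ‖f₂(x,h) − f₁(x,h)‖ ≤ C·|h|^r for all x ∈ U′ and |h| < a′; (iii) D₂^j f₂(x,0) = D₂^j f₁(x,0) for every x ∈ U and every j with 0 ≤ j ≤ r−1. -/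
open Set

noncomputable section

open scoped ContDiff Topology

section OrderContact

variable {E F : Type*} [NormedAddCommGroup E] [NormedSpace ℝ E]
  [NormedAddCommGroup F] [NormedSpace ℝ F]

/-- The iterated derivatives of the slice `h ↦ g (x, h)` are the iterated Fréchet derivatives
of `g` evaluated in the direction `(0, 1)`. -/
theorem iteratedDerivWithin_slice_eq_iteratedFDeriv {U : Set E} (hU : IsOpen U) {I : Set ℝ}
    (hI : IsOpen I) {g : E × ℝ → F} (hg : ContDiffOn ℝ ∞ g (U ×ˢ I)) {x : E} (hx : x ∈ U)
    (k : ℕ) {h : ℝ} (hh : h ∈ I) :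
    iteratedDerivWithin k (fun s => g (x, s)) I h =
      iteratedFDeriv ℝ k g (x, h) (fun _ => ((0 : E), (1 : ℝ))) := by
  induction k generalizing h with
  | zero => simp
  | succ k ih =>
    rw [iteratedDerivWithin_succ, derivWithin_congr (fun s hs => ih hs) (ih hh),
      derivWithin_of_isOpen hI hh]
    have hgh : ContDiffAt ℝ (k + 1) g ((x, (0 : ℝ)) + h • ((0 : E), (1 : ℝ))) := by
      have := hg.contDiffAt ((hU.prod hI).mem_nhds (mk_mem_prod hx hh))
      simpa using this.of_le (by exact_mod_cast le_top)
    simpa using hgh.deriv_fderiv_add_smul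

/-- A smooth function whose derivatives of order `< r` in the last variable vanish along `h = 0`
is the product of `h ^ r` and a continuous function. -/
theorem exists_continuousOn_eq_pow_smul [CompleteSpace F] {U : Set E} (hU : IsOpen U) {a : ℝ}
    {g : E × ℝ → F} (hg : ContDiffOn ℝ ∞ g (U ×ˢ Ioo (-a) a)) {r : ℕ} (hr : 1 ≤ r)
    (hvanish : ∀ x ∈ U, ∀ j < r, iteratedDerivWithin j (fun h => g (x, h)) (Ioo (-a) a) 0 = 0) :
    ∃ δ : E × ℝ → F, ContinuousOn δ (U ×ˢ Ioo (-a) a) ∧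
      ∀ x ∈ U, ∀ h ∈ Ioo (-a) a, g (x, h) = h ^ r • δ (x, h) := by
  obtain ⟨n, rfl⟩ : ∃ n, r = n + 1 := ⟨r - 1, by omega⟩
  set S := U ×ˢ Ioo (-a) a
  have hSo : IsOpen S := hU.prod isOpen_Ioo
  have hscale : ∀ {x : E} {h t : ℝ}, x ∈ U → h ∈ Ioo (-a) a → t ∈ Icc (0 : ℝ) 1 →
      (x, t * h) ∈ S := by
    intro x h t hx hh ht
    refine mk_mem_prod hx (abs_lt.mp ?_)
    rw [abs_mul, abs_of_nonneg ht.1]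
    exact (mul_le_of_le_one_left (abs_nonneg h) ht.2).trans_lt (abs_lt.mpr hh)
  have hdir : ∀ (k : ℕ) (p : E × ℝ) (h : ℝ),
      iteratedFDeriv ℝ k g p (fun _ => ((0 : E), h)) =
        h ^ k • iteratedFDeriv ℝ k g p (fun _ => ((0 : E), (1 : ℝ))) := by
    intro k p h
    simpa using (iteratedFDeriv ℝ k g p).map_smul_univ (fun _ => h)
      (fun _ => ((0 : E), (1 : ℝ)))
  refine ⟨fun p => ((n.factorial : ℝ))⁻¹ • ∫ t in (0 : ℝ)..1, (1 - t) ^ n •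
    iteratedFDeriv ℝ (n + 1) g (p.1, t * p.2) (fun _ => ((0 : E), (1 : ℝ))), ?_, ?_⟩
  · have hD : ContinuousOn
        (fun p => iteratedFDeriv ℝ (n + 1) g p (fun _ => ((0 : E), (1 : ℝ)))) S := by
      intro p hp
      have hc : ContDiffAt ℝ ((0 : ℕ∞) + (n + 1 : ℕ)) g p :=
        (hg.contDiffAt (hSo.mem_nhds hp)).of_le (by exact_mod_cast le_top)
      have := (hc.iteratedFDeriv_right (m := 0) (i := n + 1) (by simp)).continuousAt
      exact (this.eval_const _).continuousWithinAt
    rw [continuousOn_iff_continuous_domRestrict]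
    have hproj : ∀ q : S × ℝ,
        ((q.1.1.1, (projIcc (0 : ℝ) 1 zero_le_one q.2 : ℝ) * q.1.1.2) : E × ℝ) ∈ S :=
      fun q => hscale q.1.2.1 q.1.2.2 (projIcc (0 : ℝ) 1 zero_le_one q.2).2
    have hcont : Continuous (Function.uncurry fun (p : S) (t : ℝ) => (1 - t) ^ n •
        iteratedFDeriv ℝ (n + 1) g
          (p.1.1, (projIcc (0 : ℝ) 1 zero_le_one t : ℝ) * p.1.2)
          (fun _ => ((0 : E), (1 : ℝ)))) := by
      refine Continuous.smul (by fun_prop) (hD.comp_continuous ?_ hproj)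
      have := continuous_projIcc (a := (0 : ℝ)) (b := 1) (h := zero_le_one)
      fun_prop
    refine ((intervalIntegral.continuous_parametric_intervalIntegral_of_continuous'
      (μ := MeasureTheory.volume) hcont 0 1).const_smul ((n.factorial : ℝ))⁻¹).congr fun p => ?_
    rw [Set.domRestrict_apply]
    refine congrArg (fun v : F => ((n.factorial : ℝ))⁻¹ • v) (intervalIntegral.integral_congr fun t ht => ?_)
    rw [uIcc_of_le zero_le_one] at ht
    simp only [projIcc_of_mem zero_le_one ht]
  · intro x hx h hh
    have h0 : (0 : ℝ) ∈ Ioo (-a) a := by simpa using (hscale hx hh ⟨le_rfl, zero_le_one⟩).2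
    have htaylor := map_add_eq_sum_add_integral_iteratedFDeriv (f := g) (n := n)
      (x := (x, (0 : ℝ))) (y := ((0 : E), h)) fun t ht => by
        have := hg.contDiffAt (hSo.mem_nhds (hscale hx hh ht))
        simpa using this.of_le (by exact_mod_cast le_top)
    have hzero : ∀ k ∈ Finset.range (n + 1), ((k.factorial : ℝ))⁻¹ •
        iteratedFDeriv ℝ k g (x, (0 : ℝ)) (fun _ => ((0 : E), h)) = 0 := by
      intro k hk
      rw [hdir, ← iteratedDerivWithin_slice_eq_iteratedFDeriv hU isOpen_Ioo hg hx k h0,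
        hvanish x hx k (Finset.mem_range.mp hk), smul_zero, smul_zero]
    rw [Finset.sum_eq_zero hzero] at htaylor
    simp only [Prod.mk_add_mk, add_zero, zero_add, Prod.smul_mk, smul_zero, smul_eq_mul]
      at htaylor
    rw [htaylor, smul_comm (h ^ (n + 1)), ← intervalIntegral.integral_smul (h ^ (n + 1))]
    refine congrArg (fun v : F => ((n.factorial : ℝ))⁻¹ • v)
      (intervalIntegral.integral_congr fun t _ => ?_)
    simp only [hdir (n + 1) _ h]
    exact smul_comm _ _ _

/-- If a smooth function of one real variable is `O(h ^ r)` at `0`, then its derivatives of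
order `< r` vanish at `0`. -/
theorem iteratedDerivWithin_eq_zero_of_norm_le_pow {φ : ℝ → F} {s : Set ℝ} (hs : Convex ℝ s)
    (hs0 : s ∈ 𝓝 0) (hφ : ContDiffOn ℝ ∞ φ s) {r : ℕ}
    (hO : φ =O[𝓝 0] fun h : ℝ => h ^ r) {j : ℕ} (hj : j < r) :
    iteratedDerivWithin j φ s 0 = 0 := by
  induction j using Nat.strong_induction_on with
  | _ j ih =>
    have htaylor := taylor_isLittleO (n := j) hs (mem_of_mem_nhds hs0)
      (hφ.of_le (by exact_mod_cast le_top))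
    rw [nhdsWithin_eq_nhds.mpr hs0] at htaylor
    simp only [sub_zero] at htaylor
    have hφo : φ =o[𝓝 0] fun h : ℝ => h ^ j :=
      hO.trans_isLittleO (Asymptotics.isLittleO_pow_pow hj)
    have hsub := hφo.sub htaylor
    have hpoly : ∀ h : ℝ, φ h - (φ h - taylorWithinEval φ j s 0 h) =
        h ^ j • ((j.factorial : ℝ)⁻¹ • iteratedDerivWithin j φ s 0) := by
      intro h
      rw [sub_sub_cancel, taylor_within_apply, Finset.sum_range_succ, Finset.sum_eq_zero]
      · simp [smul_smul, mul_comm]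
      · intro k hk
        have hkj := Finset.mem_range.mp hk
        rw [ih k hkj (hkj.trans hj), smul_zero]
    simp only [hpoly] at hsub
    set c := (j.factorial : ℝ)⁻¹ • iteratedDerivWithin j φ s 0
    have hlim : Filter.Tendsto (fun _ : ℝ => c) (𝓝[≠] 0) (𝓝 0) := by
      rw [← Asymptotics.isLittleO_one_iff ℝ]
      refine Asymptotics.isLittleO_iff.mpr fun ε hε => ?_
      filter_upwards [(Asymptotics.isLittleO_iff.mp hsub hε).filter_mono nhdsWithin_le_nhds,
        self_mem_nhdsWithin] with h hh hne
      rw [norm_smul, mul_comm] at hh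
      have hpos : 0 < ‖h ^ j‖ := norm_pos_iff.mpr (pow_ne_zero _ hne)
      simpa using le_of_mul_le_mul_right hh hpos
    have hc0 : c = 0 := tendsto_nhds_unique tendsto_const_nhds hlim
    have hfac : (j.factorial : ℝ)⁻¹ ≠ 0 := by positivity
    exact (smul_eq_zero.mp hc0).resolve_left hfac

end OrderContact

/-- A function that is `h ^ r` times a continuous function is locally uniformly `O(h ^ r)`. -/
theorem exists_norm_le_pow_of_eq_pow_smul {E F : Type*} [PseudoMetricSpace E]
    [SeminormedAddCommGroup F] [NormedSpace ℝ F] {U : Set E} (hU : IsOpen U) {a : ℝ} (ha : 0 < a)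
    {g δ : E × ℝ → F} (hδ : ContinuousOn δ (U ×ˢ Ioo (-a) a)) {r : ℕ}
    (hg : ∀ x ∈ U, ∀ h ∈ Ioo (-a) a, g (x, h) = h ^ r • δ (x, h)) {x₀ : E} (hx₀ : x₀ ∈ U) :
    ∃ U' : Set E, IsOpen U' ∧ U' ⊆ U ∧ x₀ ∈ U' ∧
      ∃ a' : ℝ, 0 < a' ∧ a' ≤ a ∧ ∃ C : ℝ, 0 ≤ C ∧
        ∀ x ∈ U', ∀ h : ℝ, |h| < a' → ‖g (x, h)‖ ≤ C * |h| ^ r := by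
  have hmem : U ×ˢ Ioo (-a) a ∈ 𝓝 (x₀, (0 : ℝ)) :=
    (hU.prod isOpen_Ioo).mem_nhds (mk_mem_prod hx₀ ⟨neg_lt_zero.mpr ha, ha⟩)
  have hbound : ∀ᶠ p in 𝓝 (x₀, (0 : ℝ)), ‖δ p‖ < ‖δ (x₀, 0)‖ + 1 :=
    (hδ.continuousAt hmem).norm.eventually_lt_const (lt_add_one _)
  obtain ⟨ε, hε, hball⟩ := Metric.eventually_nhds_iff_ball.mp (hbound.and hmem)
  refine ⟨Metric.ball x₀ ε ∩ U, Metric.isOpen_ball.inter hU, inter_subset_right,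
    ⟨Metric.mem_ball_self hε, hx₀⟩, min ε a, lt_min hε ha, min_le_right _ _,
    ‖δ (x₀, 0)‖ + 1, by positivity, fun x hx h hh => ?_⟩
  have hp : (x, h) ∈ Metric.ball (x₀, (0 : ℝ)) ε := by
    rw [← ball_prod_same]
    exact mk_mem_prod hx.1 (by simpa using hh.trans_le (min_le_left _ _))
  obtain ⟨hlt, hin⟩ := hball _ hp
  rw [hg x hx.2 h hin.2, norm_smul, norm_pow, Real.norm_eq_abs, mul_comm]
  gcongr

/-- For smooth maps on `U × (−a,a)`, the following are equivalent: (i) the difference factors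
continuously through `h^r`; (ii) local uniform bounds `‖f₂ − f₁‖ ≤ C·|h|^r`; (iii) the partial
derivatives in `h` at `h = 0` agree up to order `r−1`. -/
theorem order_contact_characterizations
    {n m : ℕ} (U : Set (EuclideanSpace ℝ (Fin n))) (hU : IsOpen U)
    (a : ℝ) (ha : 0 < a)
    (f₁ f₂ : EuclideanSpace ℝ (Fin n) × ℝ → EuclideanSpace ℝ (Fin m))
    (hf₁ : ContDiffOn ℝ (⊤ : ℕ∞) f₁ (U ×ˢ Ioo (-a) a))
    (hf₂ : ContDiffOn ℝ (⊤ : ℕ∞) f₂ (U ×ˢ Ioo (-a) a))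
    (r : ℕ) (hr1 : 1 ≤ r) :
    ((∃ δf : EuclideanSpace ℝ (Fin n) × ℝ → EuclideanSpace ℝ (Fin m),
        ContinuousOn δf (U ×ˢ Ioo (-a) a) ∧
        ∀ x ∈ U, ∀ h ∈ Ioo (-a) a, f₂ (x, h) - f₁ (x, h) = h ^ r • δf (x, h)) ↔
      (∀ x₀ ∈ U, ∃ U' : Set (EuclideanSpace ℝ (Fin n)),
        IsOpen U' ∧ U' ⊆ U ∧ x₀ ∈ U' ∧
        ∃ a' : ℝ, 0 < a' ∧ a' ≤ a ∧ ∃ C : ℝ, 0 ≤ C ∧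
          ∀ x ∈ U', ∀ h : ℝ, |h| < a' →
            ‖f₂ (x, h) - f₁ (x, h)‖ ≤ C * |h| ^ r)) ∧
    ((∀ x₀ ∈ U, ∃ U' : Set (EuclideanSpace ℝ (Fin n)),
        IsOpen U' ∧ U' ⊆ U ∧ x₀ ∈ U' ∧
        ∃ a' : ℝ, 0 < a' ∧ a' ≤ a ∧ ∃ C : ℝ, 0 ≤ C ∧
          ∀ x ∈ U', ∀ h : ℝ, |h| < a' →
            ‖f₂ (x, h) - f₁ (x, h)‖ ≤ C * |h| ^ r) ↔
      (∀ x ∈ U, ∀ j < r,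
        iteratedDerivWithin j (fun h => f₂ (x, h)) (Ioo (-a) a) 0 =
          iteratedDerivWithin j (fun h => f₁ (x, h)) (Ioo (-a) a) 0)) := by
  have hg : ContDiffOn ℝ ∞ (fun p => f₂ p - f₁ p) (U ×ˢ Ioo (-a) a) := hf₂.sub hf₁
  have h0 : (0 : ℝ) ∈ Ioo (-a) a := ⟨neg_lt_zero.mpr ha, ha⟩
  have hslice : ∀ {f : EuclideanSpace ℝ (Fin n) × ℝ → EuclideanSpace ℝ (Fin m)},
      ContDiffOn ℝ ∞ f (U ×ˢ Ioo (-a) a) → ∀ x ∈ U,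
        ContDiffOn ℝ ∞ (fun h => f (x, h)) (Ioo (-a) a) :=
    fun hf x hx => hf.comp (by fun_prop) fun h hh => mk_mem_prod hx hh
  have hderiv : ∀ x ∈ U, ∀ j : ℕ,
      iteratedDerivWithin j (fun h => f₂ (x, h) - f₁ (x, h)) (Ioo (-a) a) 0 =
        iteratedDerivWithin j (fun h => f₂ (x, h)) (Ioo (-a) a) 0 -
          iteratedDerivWithin j (fun h => f₁ (x, h)) (Ioo (-a) a) 0 := fun x hx j =>
    iteratedDerivWithin_sub h0 isOpen_Ioo.uniqueDiffOn
      ((hslice hf₂ x hx 0 h0).of_le (by exact_mod_cast le_top))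
      ((hslice hf₁ x hx 0 h0).of_le (by exact_mod_cast le_top))
  have hcycle : ∀ {P Q R : Prop}, (P → Q) → (Q → R) → (R → P) → (P ↔ Q) ∧ (Q ↔ R) := by tauto
  refine hcycle ?_ ?_ ?_
  · rintro ⟨δ, hδ, heq⟩ x₀ hx₀
    exact exists_norm_le_pow_of_eq_pow_smul (g := fun p => f₂ p - f₁ p) hU ha hδ heq hx₀
  · intro hbound x hx j hj
    obtain ⟨U', -, -, hxU', a', ha', -, C, -, hC⟩ := hbound x hx
    rw [← sub_eq_zero, ← hderiv x hx]
    refine iteratedDerivWithin_eq_zero_of_norm_le_pow (convex_Ioo _ _) (isOpen_Ioo.mem_nhds h0)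
      (hslice hg x hx) (Asymptotics.IsBigO.of_bound C ?_) hj
    filter_upwards [Metric.ball_mem_nhds (0 : ℝ) ha'] with h hh
    simpa using hC x hxU' h (by simpa using hh)
  · intro hvanish
    exact exists_continuousOn_eq_pow_smul hU hg hr1 fun x hx j hj => by
      rw [hderiv x hx, hvanish x hx j hj, sub_self]
end
end

section
/- Let n ≥ 1, let r ≥ 1 be a natural number, and let U ⊆ ℝ × ℝ^n × ℝ^n × ℝ^n be an open set containing a point (0, x₀, a₀, b₀). For j = 1, 2 let χ^j : U → ℝ^n and ς^j : U → ℝ^n be smooth maps such that χ^j(0,x,a,b) = x and ς^j(0,x,a,b) = −(a+b)/2 whenever (0,x,a,b) ∈ U, and suppose there exist continuous maps δχ, δς : U → ℝ^n with χ²(h,x,a,b) − χ¹(h,x,a,b) = h^r·δχ(h,x,a,b) and ς²(h,x,a,b) − ς¹(h,x,a,b) = h^r·δς(h,x,a,b) on U. For z ∈ U define the 2n×2n matrix B^j(z) with block form [[D_x χ^j(z), D_a χ^j(z)], [D_x ς^j(z), D_a ς^j(z)]] and the 2n×n matrix A^j(z) = [[D_b χ^j(z)], [D_b ς^j(z)]],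 where D_x, D_a, D_b denote the partial derivatives with respect to the three ℝ^n-blocks of variables. Then: (i) B^j(0,x,a,b) = [[I, 0], [0, −I/2]] and A^j(0,x,a,b) = [[0], [−I/2]] whenever (0,x,a,b) ∈ U; (ii) there is an open neighborhood U′ ⊆ U of (0, x₀, a₀, b₀) on which B¹(z) and B²(z) are invertible; and (iii) there is a continuous map C : U′ → ℝ^{2n×n} with B¹(z)^{−1}A¹(z) − B²(z)^{−1}A²(z) = h^r·C(z) for all z = (h,x,a,b) ∈ U′. -/
open Set

noncomputable section

namespace KernelDistributionContact

/-- Abbreviation for `ℝ^n`. -/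
abbrev V (n : ℕ) := EuclideanSpace ℝ (Fin n)

/-- The ambient space of variables `z = (h, x, a, b)`. -/
abbrev P (n : ℕ) := ℝ × V n × V n × V n

/-- Partial Fréchet derivative with respect to the `x`-block. -/
def Dx {n : ℕ} (χ : P n → V n) (z : P n) : V n →L[ℝ] V n :=
  fderiv ℝ (fun x => χ (z.1, x, z.2.2.1, z.2.2.2)) z.2.1

/-- Partial Fréchet derivative with respect to the `a`-block. -/
def Da {n : ℕ} (χ : P n → V n) (z : P n) : V n →L[ℝ] V n :=
  fderiv ℝ (fun a => χ (z.1, z.2.1, a, z.2.2.2)) z.2.2.1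

/-- Partial Fréchet derivative with respect to the `b`-block. -/
def Db {n : ℕ} (χ : P n → V n) (z : P n) : V n →L[ℝ] V n :=
  fderiv ℝ (fun b => χ (z.1, z.2.1, z.2.2.1, b)) z.2.2.2

/-- The `2n×2n` block operator `B = [[D_x χ, D_a χ], [D_x ς, D_a ς]]`. -/
def Bmat {n : ℕ} (χ ς : P n → V n) (z : P n) : V n × V n →L[ℝ] V n × V n :=
  ((Dx χ z).coprod (Da χ z)).prod ((Dx ς z).coprod (Da ς z))

/-- The `2n×n` block operator `A = [[D_b χ], [D_b ς]]`. -/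
def Amat {n : ℕ} (χ ς : P n → V n) (z : P n) : V n →L[ℝ] V n × V n :=
  (Db χ z).prod (Db ς z)

theorem dense_fst_ne_zero {E : Type*} [TopologicalSpace E] : Dense {z : ℝ × E | z.1 ≠ 0} := by
  have : {z : ℝ × E | z.1 ≠ 0} = ({0}ᶜ : Set ℝ) ×ˢ univ := by ext; simp
  rw [this]
  exact (dense_compl_singleton 0).prod dense_univ

section SmoothDivision

universe u

variable {E F : Type u} [NormedAddCommGroup E] [NormedSpace ℝ E] [NormedAddCommGroup F]
  [NormedSpace ℝ F]

theorem hasFDerivAt_intervalIntegral_of_contDiff [ProperSpace E] {φ : E × ℝ → F}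
    (hφ : ContDiff ℝ 1 φ) (x₀ : E) :
    HasFDerivAt (fun x => ∫ t in (0 : ℝ)..1, φ (x, t))
      (∫ t in (0 : ℝ)..1, (fderiv ℝ φ (x₀, t)).comp (ContinuousLinearMap.inl ℝ E ℝ)) x₀ := by
  have hcont : Continuous fun p : E × ℝ =>
      (fderiv ℝ φ p).comp (ContinuousLinearMap.inl ℝ E ℝ) :=
    (hφ.continuous_fderiv one_ne_zero).clm_comp continuous_const
  obtain ⟨M, hM⟩ := ((isCompact_closedBall x₀ 1).prod (isCompact_Icc (a := (0 : ℝ)) (b := 1)))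
    |>.exists_bound_of_continuousOn hcont.continuousOn
  refine intervalIntegral.hasFDerivAt_integral_of_dominated_of_fderiv_le (μ := MeasureTheory.volume)
    (F := fun x t => φ (x, t))
    (F' := fun x t => (fderiv ℝ φ (x, t)).comp (ContinuousLinearMap.inl ℝ E ℝ))
    (bound := fun _ => M) (Metric.closedBall_mem_nhds x₀ one_pos) ?_ ?_ ?_ ?_ ?_ ?_
  · exact .of_forall fun x =>
      (hφ.continuous.comp (Continuous.prodMk_right x)).aestronglyMeasurable
  · exact (hφ.continuous.comp (Continuous.prodMk_right x₀)).intervalIntegrable _ _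
  · exact (hcont.comp (Continuous.prodMk_right x₀)).aestronglyMeasurable
  · refine .of_forall fun t ht x hx => hM (x, t) ⟨hx, ?_⟩
    rw [uIoc_of_le zero_le_one] at ht
    exact Ioc_subset_Icc_self ht
  · exact intervalIntegrable_const
  · exact .of_forall fun t _ x _ =>
      ((hφ.differentiable one_ne_zero (x, t)).hasFDerivAt).comp x (hasFDerivAt_prodMk_left x t)

theorem contDiff_nat_intervalIntegral [ProperSpace E] (m : ℕ) {φ : E × ℝ → F}
    (hφ : ContDiff ℝ m φ) : ContDiff ℝ m (fun x => ∫ t in (0 : ℝ)..1, φ (x, t)) := by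
  induction m generalizing F with
  | zero =>
    rw [Nat.cast_zero, contDiff_zero] at hφ ⊢
    exact intervalIntegral.continuous_parametric_intervalIntegral_of_continuous'
      (f := fun x t => φ (x, t)) hφ 0 1
  | succ k ih =>
    have hderiv := hasFDerivAt_intervalIntegral_of_contDiff
      (hφ.of_le (by exact_mod_cast Nat.le_add_left 1 k))
    rw [Nat.cast_succ, contDiff_succ_iff_fderiv] at hφ ⊢
    refine ⟨fun x => (hderiv x).differentiableAt, by simp, ?_⟩
    rw [funext fun x => (hderiv x).fderiv]
    exact ih (hφ.2.2.clm_comp contDiff_const)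

theorem contDiff_intervalIntegral [ProperSpace E] {φ : E × ℝ → F}
    (hφ : ContDiff ℝ (⊤ : ℕ∞) φ) :
    ContDiff ℝ (⊤ : ℕ∞) (fun x => ∫ t in (0 : ℝ)..1, φ (x, t)) :=
  contDiff_infty.2 fun m => contDiff_nat_intervalIntegral m (contDiff_infty.1 hφ m)

/-- Hadamard's lemma in the first variable. -/
theorem exists_contDiff_eq_fst_smul [ProperSpace E] [CompleteSpace F] {f : ℝ × E → F} (hf : ContDiff ℝ (⊤ : ℕ∞) f)
    (h0 : ∀ y, f (0, y) = 0) :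
    ∃ g : ℝ × E → F, ContDiff ℝ (⊤ : ℕ∞) g ∧ ∀ z, f z = z.1 • g z := by
  refine ⟨fun z => ∫ t in (0 : ℝ)..1, fderiv ℝ f (t * z.1, z.2) (1, 0), ?_, ?_⟩
  · refine contDiff_intervalIntegral
      (φ := fun p : (ℝ × E) × ℝ => fderiv ℝ f (p.2 * p.1.1, p.1.2) (1, 0)) ?_
    have hfd : ContDiff ℝ (⊤ : ℕ∞) (fderiv ℝ f) := hf.fderiv_right (by simp)
    exact (hfd.comp (by fun_prop : ContDiff ℝ (⊤ : ℕ∞)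
      fun p : (ℝ × E) × ℝ => (p.2 * p.1.1, p.1.2))).clm_apply contDiff_const
  · rintro ⟨h, y⟩
    have hderiv (t : ℝ) : HasDerivAt (fun t : ℝ => f (t * h, y))
        (h • fderiv ℝ f (t * h, y) (1, 0)) t := by
      have hpath : HasDerivAt (fun t : ℝ => (t * h, y)) (h, (0 : E)) t := by
        simpa using ((hasDerivAt_id t).mul_const h).prodMk (hasDerivAt_const t y)
      rw [← map_smul, Prod.smul_mk, smul_eq_mul, mul_one, smul_zero]
      exact ((hf.differentiable (by simp) (t * h, y)).hasFDerivAt).comp_hasDerivAt t hpath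
    have hcont : Continuous fun t : ℝ => h • fderiv ℝ f (t * h, y) (1, 0) := by
      have := hf.continuous_fderiv (by simp)
      fun_prop
    have hFTC := intervalIntegral.integral_eq_sub_of_hasDerivAt (a := 0) (b := 1)
      (fun t _ => hderiv t) (hcont.intervalIntegrable _ _)
    rw [intervalIntegral.integral_smul] at hFTC
    simpa [h0] using hFTC.symm

/-- A continuous quotient of a smooth map by a power of the first coordinate is smooth. -/
theorem contDiff_of_eq_fst_pow_smul [ProperSpace E] [CompleteSpace F] (r : ℕ) {f δ : ℝ × E → F} (hf : ContDiff ℝ (⊤ : ℕ∞) f)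
    (hδ : Continuous δ) (hfac : ∀ z, f z = z.1 ^ r • δ z) : ContDiff ℝ (⊤ : ℕ∞) δ := by
  induction r generalizing f with
  | zero =>
    have : f = δ := funext fun z => by simpa using hfac z
    exact this ▸ hf
  | succ k ih =>
    obtain ⟨g, hg, hfg⟩ := exists_contDiff_eq_fst_smul hf fun y => by simp [hfac]
    refine ih hg (congrFun (Continuous.ext_on dense_fst_ne_zero hg.continuous
      ((continuous_fst.pow k).smul hδ) fun z (hz : z.1 ≠ 0) => ?_))
    have h := (hfg z).symm.trans (hfac z)
    rw [pow_succ', mul_smul] at h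
    exact smul_right_injective F hz h

theorem contDiffOn_of_eq_fst_pow_smul [FiniteDimensional ℝ E] [CompleteSpace F] (r : ℕ)
    {U : Set (ℝ × E)} (hU : IsOpen U) {f δ : ℝ × E → F} (hf : ContDiffOn ℝ (⊤ : ℕ∞) f U)
    (hδ : ContinuousOn δ U) (hfac : ∀ z ∈ U, f z = z.1 ^ r • δ z) :
    ContDiffOn ℝ (⊤ : ℕ∞) δ U := by
  intro z hz
  obtain ⟨b, hbU, -, hb, -, hbz⟩ := exists_contDiff_tsupport_subset (n := ⊤) (hU.mem_nhds hz)
  have hbf : ContDiff ℝ (⊤ : ℕ∞) (fun w => b w • f w) := by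
    refine contDiff_iff_contDiffAt.2 fun w => ?_
    by_cases hw : w ∈ tsupport b
    · exact hb.contDiffAt.smul (hf.contDiffAt (hU.mem_nhds (hbU hw)))
    · refine (contDiffAt_const (c := (0 : F))).congr_of_eventuallyEq ?_
      filter_upwards [notMem_tsupport_iff_eventuallyEq.1 hw] with v hv
      simp [hv]
  have hbδ : Continuous (fun w => b w • δ w) := by
    refine continuous_of_tsupport fun w hw => ?_
    have hwU : w ∈ U := hbU (tsupport_smul_subset_left b δ hw)
    exact hb.continuous.continuousAt.smul (hδ.continuousAt (hU.mem_nhds hwU))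
  have hsmooth := contDiff_of_eq_fst_pow_smul r hbf hbδ fun w => by
    by_cases hw : w ∈ U
    · rw [hfac w hw, smul_comm]
    · simp [image_eq_zero_of_notMem_tsupport fun h => hw (hbU h)]
  have hb0 : b z ≠ 0 := by simp [hbz]
  refine (((hb.contDiffAt.inv hb0).smul hsmooth.contDiffAt).congr_of_eventuallyEq
    ?_).contDiffWithinAt
  filter_upwards [hb.continuous.continuousAt.eventually_ne hb0] with w hw
  simp [smul_smul, inv_mul_cancel₀ hw]

/-- Derivatives in directions transverse to the first coordinate preserve contact of order
`r` along its zero set. -/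
theorem fderiv_comp_sub_of_eq_fst_pow_smul {G : Type*} [NormedAddCommGroup G] [NormedSpace ℝ G]
    (r : ℕ) {U : Set (ℝ × E)} (hU : IsOpen U) {f₁ f₂ δ : ℝ × E → F} {z : ℝ × E} (hz : z ∈ U)
    (hf₁ : DifferentiableAt ℝ f₁ z) (hf₂ : DifferentiableAt ℝ f₂ z)
    (hδ : DifferentiableAt ℝ δ z) (hfac : ∀ z ∈ U, f₂ z - f₁ z = z.1 ^ r • δ z)
    (L : G →L[ℝ] E) :
    (fderiv ℝ f₂ z).comp ((ContinuousLinearMap.inr ℝ ℝ E).comp L) -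
        (fderiv ℝ f₁ z).comp ((ContinuousLinearMap.inr ℝ ℝ E).comp L) =
      z.1 ^ r • (fderiv ℝ δ z).comp ((ContinuousLinearMap.inr ℝ ℝ E).comp L) := by
  have hpow : HasFDerivAt (fun w : ℝ × E => w.1 ^ r)
      ((r * z.1 ^ (r - 1)) • ContinuousLinearMap.fst ℝ ℝ E) z :=
    (hasDerivAt_pow r z.1).comp_hasFDerivAt z hasFDerivAt_fst
  have heq : (fun w => f₂ w - f₁ w) =ᶠ[nhds z] fun w => w.1 ^ r • δ w :=
    Filter.eventuallyEq_of_mem (hU.mem_nhds hz) hfac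
  have h := (hf₂.hasFDerivAt.sub hf₁.hasFDerivAt).unique
    ((hpow.smul hδ.hasFDerivAt).congr_of_eventuallyEq heq)
  rw [← ContinuousLinearMap.sub_comp, h]
  ext v
  simp

end SmoothDivision

section Blocks

variable {n : ℕ} {χ ς : P n → V n} {z : P n}

/-- The inclusion of the `(x, a)`-directions into the spatial directions. -/
def inclXA (n : ℕ) : V n × V n →L[ℝ] V n × V n × V n :=
  (ContinuousLinearMap.inl ℝ (V n) (V n × V n)).coprod
    ((ContinuousLinearMap.inr ℝ (V n) (V n × V n)).comp (ContinuousLinearMap.inl ℝ (V n) (V n)))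

/-- The inclusion of the `b`-directions into the spatial directions. -/
def inclB (n : ℕ) : V n →L[ℝ] V n × V n × V n :=
  (ContinuousLinearMap.inr ℝ (V n) (V n × V n)).comp (ContinuousLinearMap.inr ℝ (V n) (V n))

theorem Dx_apply (hχ : DifferentiableAt ℝ χ z) (v : V n) :
    Dx χ z v = fderiv ℝ χ z (0, v, 0, 0) := by
  have h : HasFDerivAt (fun x => χ (z.1, x, z.2.2.1, z.2.2.2)) _ z.2.1 :=
    hχ.hasFDerivAt.comp z.2.1 ((hasFDerivAt_prodMk_right z.1 z.2).comp z.2.1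
      (hasFDerivAt_prodMk_left z.2.1 z.2.2))
  rw [Dx, h.fderiv]
  simp [← Prod.zero_eq_mk]

theorem Da_apply (hχ : DifferentiableAt ℝ χ z) (v : V n) :
    Da χ z v = fderiv ℝ χ z (0, 0, v, 0) := by
  have h : HasFDerivAt (fun a => χ (z.1, z.2.1, a, z.2.2.2)) _ z.2.2.1 :=
    hχ.hasFDerivAt.comp z.2.2.1 ((hasFDerivAt_prodMk_right z.1 z.2).comp z.2.2.1
      ((hasFDerivAt_prodMk_right z.2.1 z.2.2).comp z.2.2.1
        (hasFDerivAt_prodMk_left z.2.2.1 z.2.2.2)))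
  rw [Da, h.fderiv]
  simp

theorem Db_apply (hχ : DifferentiableAt ℝ χ z) (v : V n) :
    Db χ z v = fderiv ℝ χ z (0, 0, 0, v) := by
  have h : HasFDerivAt (fun b => χ (z.1, z.2.1, z.2.2.1, b)) _ z.2.2.2 :=
    hχ.hasFDerivAt.comp z.2.2.2 ((hasFDerivAt_prodMk_right z.1 z.2).comp z.2.2.2
      ((hasFDerivAt_prodMk_right z.2.1 z.2.2).comp z.2.2.2
        (hasFDerivAt_prodMk_right z.2.2.1 z.2.2.2)))
  rw [Db, h.fderiv]
  simp

theorem Bmat_eq_fderiv_comp (hχ : DifferentiableAt ℝ χ z) (hς : DifferentiableAt ℝ ς z) :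
    Bmat χ ς z = (fderiv ℝ (fun w => (χ w, ς w)) z).comp
      ((ContinuousLinearMap.inr ℝ ℝ _).comp (inclXA n)) := by
  refine ContinuousLinearMap.ext fun v => ?_
  rw [hχ.fderiv_prodMk hς]
  simp [Bmat, inclXA, Dx_apply, Da_apply, hχ, hς, ← map_add]

theorem Amat_eq_fderiv_comp (hχ : DifferentiableAt ℝ χ z) (hς : DifferentiableAt ℝ ς z) :
    Amat χ ς z = (fderiv ℝ (fun w => (χ w, ς w)) z).comp
      ((ContinuousLinearMap.inr ℝ ℝ _).comp (inclB n)) := by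
  refine ContinuousLinearMap.ext fun v => ?_
  rw [hχ.fderiv_prodMk hς]
  simp [Amat, inclB, Db_apply, hχ, hς]

variable {U : Set (P n)}

theorem continuousOn_Bmat (hU : IsOpen U) (hχ : ContDiffOn ℝ (⊤ : ℕ∞) χ U)
    (hς : ContDiffOn ℝ (⊤ : ℕ∞) ς U) : ContinuousOn (Bmat χ ς) U :=
  (((hχ.prodMk hς).continuousOn_fderiv_of_isOpen hU (by simp)).clm_comp
    continuousOn_const).congr fun z hz => Bmat_eq_fderiv_comp
      ((hχ.contDiffAt (hU.mem_nhds hz)).differentiableAt (by simp))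
      ((hς.contDiffAt (hU.mem_nhds hz)).differentiableAt (by simp))

theorem continuousOn_Amat (hU : IsOpen U) (hχ : ContDiffOn ℝ (⊤ : ℕ∞) χ U)
    (hς : ContDiffOn ℝ (⊤ : ℕ∞) ς U) : ContinuousOn (Amat χ ς) U :=
  (((hχ.prodMk hς).continuousOn_fderiv_of_isOpen hU (by simp)).clm_comp
    continuousOn_const).congr fun z hz => Amat_eq_fderiv_comp
      ((hχ.contDiffAt (hU.mem_nhds hz)).differentiableAt (by simp))
      ((hς.contDiffAt (hU.mem_nhds hz)).differentiableAt (by simp))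

theorem Bmat_Amat_of_initial (hU : IsOpen U)
    (hχ0 : ∀ x a b : V n, ((0 : ℝ), x, a, b) ∈ U → χ (0, x, a, b) = x)
    (hς0 : ∀ x a b : V n, ((0 : ℝ), x, a, b) ∈ U → ς (0, x, a, b) = (-(1 : ℝ) / 2) • (a + b))
    {x a b : V n} (hz : ((0 : ℝ), x, a, b) ∈ U) :
    Bmat χ ς (0, x, a, b) = (ContinuousLinearMap.id ℝ (V n)).prodMap
        ((-(1 : ℝ) / 2) • ContinuousLinearMap.id ℝ (V n)) ∧
      Amat χ ς (0, x, a, b) =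
        (0 : V n →L[ℝ] V n).prod ((-(1 : ℝ) / 2) • ContinuousLinearMap.id ℝ (V n)) := by
  have hx : ∀ᶠ y in nhds x, ((0 : ℝ), y, a, b) ∈ U :=
    (by fun_prop : Continuous fun y : V n => ((0 : ℝ), y, a, b)).continuousAt.eventually
      (hU.mem_nhds hz)
  have ha : ∀ᶠ y in nhds a, ((0 : ℝ), x, y, b) ∈ U :=
    (by fun_prop : Continuous fun y : V n => ((0 : ℝ), x, y, b)).continuousAt.eventually
      (hU.mem_nhds hz)
  have hb : ∀ᶠ y in nhds b, ((0 : ℝ), x, a, y) ∈ U :=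
    (by fun_prop : Continuous fun y : V n => ((0 : ℝ), x, a, y)).continuousAt.eventually
      (hU.mem_nhds hz)
  have hDxχ : Dx χ (0, x, a, b) = ContinuousLinearMap.id ℝ (V n) :=
    ((hasFDerivAt_id x).congr_of_eventuallyEq (hx.mono fun y hy => hχ0 y a b hy)).fderiv
  have hDaχ : Da χ (0, x, a, b) = 0 :=
    ((hasFDerivAt_const x a).congr_of_eventuallyEq (ha.mono fun y hy => hχ0 x y b hy)).fderiv
  have hDbχ : Db χ (0, x, a, b) = 0 :=
    ((hasFDerivAt_const x b).congr_of_eventuallyEq (hb.mono fun y hy => hχ0 x a y hy)).fderiv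
  have hDxς : Dx ς (0, x, a, b) = 0 :=
    ((hasFDerivAt_const _ x).congr_of_eventuallyEq (hx.mono fun y hy => hς0 y a b hy)).fderiv
  have hDaς : Da ς (0, x, a, b) = (-(1 : ℝ) / 2) • ContinuousLinearMap.id ℝ (V n) :=
    ((((hasFDerivAt_id a).add_const b).const_smul (-(1 : ℝ) / 2)).congr_of_eventuallyEq
      (ha.mono fun y hy => hς0 x y b hy)).fderiv
  have hDbς : Db ς (0, x, a, b) = (-(1 : ℝ) / 2) • ContinuousLinearMap.id ℝ (V n) :=
    ((((hasFDerivAt_id b).const_add a).const_smul (-(1 : ℝ) / 2)).congr_of_eventuallyEq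
      (hb.mono fun y hy => hς0 x a y hy)).fderiv
  rw [Bmat, Amat, hDxχ, hDaχ, hDbχ, hDxς, hDaς, hDbς]
  refine ⟨ContinuousLinearMap.ext fun v => ?_, rfl⟩
  exact Prod.ext (by simp) (by simp)

theorem isUnit_prodMap_id_smul_id {E F : Type*} [NormedAddCommGroup E] [NormedSpace ℝ E]
    [NormedAddCommGroup F] [NormedSpace ℝ F] {c : ℝ} (hc : c ≠ 0) :
    IsUnit ((ContinuousLinearMap.id ℝ E).prodMap (c • ContinuousLinearMap.id ℝ F)) := by
  refine isUnit_iff_exists.2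
    ⟨(ContinuousLinearMap.id ℝ E).prodMap (c⁻¹ • ContinuousLinearMap.id ℝ F), ?_, ?_⟩ <;>
  · refine ContinuousLinearMap.ext fun v => ?_
    exact Prod.ext rfl (by simp [hc])

end Blocks

theorem continuousOn_inverse_of_isUnit {X R : Type*} [TopologicalSpace X] [NormedRing R]
    [HasSummableGeomSeries R] {B : X → R} {s : Set X} (hB : ContinuousOn B s)
    (hunit : ∀ x ∈ s, IsUnit (B x)) : ContinuousOn (fun x => Ring.inverse (B x)) s := by
  intro x hx
  have h := NormedRing.inverse_continuousAt (hunit x hx).unit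
  exact ContinuousAt.comp_continuousWithinAt (f := B) h (hB x hx)

theorem inverse_comp_sub_inverse_comp {E F : Type*} [NormedAddCommGroup E] [NormedSpace ℝ E]
    [NormedAddCommGroup F] [NormedSpace ℝ F] {B₁ B₂ : E →L[ℝ] E} (h₁ : IsUnit B₁)
    (h₂ : IsUnit B₂) (A₁ A₂ : F →L[ℝ] E) :
    (Ring.inverse B₁).comp A₁ - (Ring.inverse B₂).comp A₂ =
      (Ring.inverse B₁).comp ((B₂ - B₁).comp ((Ring.inverse B₂).comp A₂) - (A₂ - A₁)) := by
  have e₁ : (Ring.inverse B₁).comp B₁ = ContinuousLinearMap.id ℝ E :=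
    Ring.inverse_mul_cancel _ h₁
  have e₂ : B₂.comp (Ring.inverse B₂) = ContinuousLinearMap.id ℝ E :=
    Ring.mul_inverse_cancel _ h₂
  have e₃ : (Ring.inverse B₁).comp (B₁.comp ((Ring.inverse B₂).comp A₂)) =
      (Ring.inverse B₂).comp A₂ := by
    rw [← ContinuousLinearMap.comp_assoc, e₁, ContinuousLinearMap.id_comp]
  have e₄ : B₂.comp ((Ring.inverse B₂).comp A₂) = A₂ := by
    rw [← ContinuousLinearMap.comp_assoc, e₂, ContinuousLinearMap.id_comp]
  simp only [ContinuousLinearMap.comp_sub, ContinuousLinearMap.sub_comp, e₃, e₄]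
  abel

/-- Local-coordinate contact of kernel distributions: for two graded submersions
`φ^j(h,x,a,b) = (h, χ^j, ς^j)` with order-`h^r` contact, (i) the blocks `B^j, A^j` take the
indicated values at `h = 0`, (ii) `B^j` is invertible near the base point, and (iii) the graphs
`−(B^j)⁻¹A^j` of the kernels differ by `h^r` times a continuous factor. -/
theorem kernel_distributions_have_contact_order
    {n : ℕ} (hn : 1 ≤ n) (r : ℕ) (hr : 1 ≤ r)
    (U : Set (P n)) (hU : IsOpen U)
    (x₀ a₀ b₀ : V n) (hpt : ((0 : ℝ), x₀, a₀, b₀) ∈ U)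
    (χ₁ χ₂ ς₁ ς₂ : P n → V n)
    (hχ₁ : ContDiffOn ℝ (⊤ : ℕ∞) χ₁ U) (hχ₂ : ContDiffOn ℝ (⊤ : ℕ∞) χ₂ U)
    (hς₁ : ContDiffOn ℝ (⊤ : ℕ∞) ς₁ U) (hς₂ : ContDiffOn ℝ (⊤ : ℕ∞) ς₂ U)
    (hχ0 : ∀ x a b : V n, ((0 : ℝ), x, a, b) ∈ U →
      χ₁ (0, x, a, b) = x ∧ χ₂ (0, x, a, b) = x)
    (hς0 : ∀ x a b : V n, ((0 : ℝ), x, a, b) ∈ U →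
      ς₁ (0, x, a, b) = (-(1 : ℝ) / 2) • (a + b) ∧
        ς₂ (0, x, a, b) = (-(1 : ℝ) / 2) • (a + b))
    (δχ δς : P n → V n) (hδχ : ContinuousOn δχ U) (hδς : ContinuousOn δς U)
    (hfacχ : ∀ z ∈ U, χ₂ z - χ₁ z = z.1 ^ r • δχ z)
    (hfacς : ∀ z ∈ U, ς₂ z - ς₁ z = z.1 ^ r • δς z) :
    (∀ x a b : V n, ((0 : ℝ), x, a, b) ∈ U →
      (Bmat χ₁ ς₁ (0, x, a, b) =
          (ContinuousLinearMap.id ℝ (V n)).prodMap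
            ((-(1 : ℝ) / 2) • ContinuousLinearMap.id ℝ (V n)) ∧
        Bmat χ₂ ς₂ (0, x, a, b) =
          (ContinuousLinearMap.id ℝ (V n)).prodMap
            ((-(1 : ℝ) / 2) • ContinuousLinearMap.id ℝ (V n))) ∧
      (Amat χ₁ ς₁ (0, x, a, b) =
          (0 : V n →L[ℝ] V n).prod ((-(1 : ℝ) / 2) • ContinuousLinearMap.id ℝ (V n)) ∧
        Amat χ₂ ς₂ (0, x, a, b) =
          (0 : V n →L[ℝ] V n).prod ((-(1 : ℝ) / 2) • ContinuousLinearMap.id ℝ (V n)))) ∧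
    (∃ U' : Set (P n), IsOpen U' ∧ U' ⊆ U ∧ ((0 : ℝ), x₀, a₀, b₀) ∈ U' ∧
      (∀ z ∈ U', IsUnit (Bmat χ₁ ς₁ z) ∧ IsUnit (Bmat χ₂ ς₂ z)) ∧
      ∃ C : P n → (V n →L[ℝ] V n × V n),
        ContinuousOn C U' ∧
        ∀ z ∈ U',
          (Ring.inverse (Bmat χ₁ ς₁ z)).comp (Amat χ₁ ς₁ z) -
              (Ring.inverse (Bmat χ₂ ς₂ z)).comp (Amat χ₂ ς₂ z) =
            z.1 ^ r • C z) := by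
  have hval₁ {x a b : V n} (hz : ((0 : ℝ), x, a, b) ∈ U) :=
    Bmat_Amat_of_initial hU (fun x a b h => (hχ0 x a b h).1) (fun x a b h => (hς0 x a b h).1) hz
  have hval₂ {x a b : V n} (hz : ((0 : ℝ), x, a, b) ∈ U) :=
    Bmat_Amat_of_initial hU (fun x a b h => (hχ0 x a b h).2) (fun x a b h => (hς0 x a b h).2) hz
  refine ⟨fun x a b hz => ⟨⟨(hval₁ hz).1, (hval₂ hz).1⟩, (hval₁ hz).2, (hval₂ hz).2⟩, ?_⟩
  have hδχ' := contDiffOn_of_eq_fst_pow_smul r hU (hχ₂.sub hχ₁) hδχ hfacχ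
  have hδς' := contDiffOn_of_eq_fst_pow_smul r hU (hς₂.sub hς₁) hδς hfacς
  have hB₁ := continuousOn_Bmat hU hχ₁ hς₁
  have hB₂ := continuousOn_Bmat hU hχ₂ hς₂
  have hsub : (U ∩ Bmat χ₁ ς₁ ⁻¹' {B | IsUnit B}) ∩ (U ∩ Bmat χ₂ ς₂ ⁻¹' {B | IsUnit B}) ⊆ U :=
    fun z hz => hz.1.1
  refine ⟨(U ∩ Bmat χ₁ ς₁ ⁻¹' {B | IsUnit B}) ∩ (U ∩ Bmat χ₂ ς₂ ⁻¹' {B | IsUnit B}),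
    (hB₁.isOpen_inter_preimage hU Units.isOpen).inter
      (hB₂.isOpen_inter_preimage hU Units.isOpen),
    hsub, ⟨⟨hpt, ?_⟩, hpt, ?_⟩, fun z hz => ⟨hz.1.2, hz.2.2⟩,
    fun z => (Ring.inverse (Bmat χ₁ ς₁ z)).comp
      ((Bmat δχ δς z).comp ((Ring.inverse (Bmat χ₂ ς₂ z)).comp (Amat χ₂ ς₂ z)) - Amat δχ δς z),
    ?_, ?_⟩
  · rw [mem_preimage, (hval₁ hpt).1]
    exact isUnit_prodMap_id_smul_id (by norm_num)
  · rw [mem_preimage, (hval₂ hpt).1]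
    exact isUnit_prodMap_id_smul_id (by norm_num)
  · have hinv₁ := continuousOn_inverse_of_isUnit (hB₁.mono hsub) fun z hz => hz.1.2
    have hinv₂ := continuousOn_inverse_of_isUnit (hB₂.mono hsub) fun z hz => hz.2.2
    exact hinv₁.clm_comp ((((continuousOn_Bmat hU hδχ' hδς').mono hsub).clm_comp
      (hinv₂.clm_comp ((continuousOn_Amat hU hχ₂ hς₂).mono hsub))).sub
        ((continuousOn_Amat hU hδχ' hδς').mono hsub))
  · intro z hz
    have hd {f : P n → V n} (hf : ContDiffOn ℝ (⊤ : ℕ∞) f U) : DifferentiableAt ℝ f z :=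
      (hf.contDiffAt (hU.mem_nhds (hsub hz))).differentiableAt (by simp)
    have hcontact {G : Type} [NormedAddCommGroup G] [NormedSpace ℝ G]
        (L : G →L[ℝ] V n × V n × V n) :=
      fderiv_comp_sub_of_eq_fst_pow_smul r hU (hsub hz) ((hd hχ₁).prodMk (hd hς₁))
        ((hd hχ₂).prodMk (hd hς₂)) ((hd hδχ').prodMk (hd hδς'))
        (fun w hw => Prod.ext (hfacχ w hw) (hfacς w hw)) L
    have hB : Bmat χ₂ ς₂ z - Bmat χ₁ ς₁ z = z.1 ^ r • Bmat δχ δς z := by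
      rw [Bmat_eq_fderiv_comp (hd hχ₁) (hd hς₁), Bmat_eq_fderiv_comp (hd hχ₂) (hd hς₂),
        Bmat_eq_fderiv_comp (hd hδχ') (hd hδς'), hcontact]
    have hA : Amat χ₂ ς₂ z - Amat χ₁ ς₁ z = z.1 ^ r • Amat δχ δς z := by
      rw [Amat_eq_fderiv_comp (hd hχ₁) (hd hς₁), Amat_eq_fderiv_comp (hd hχ₂) (hd hς₂),
        Amat_eq_fderiv_comp (hd hδχ') (hd hδς'), hcontact]
    rw [inverse_comp_sub_inverse_comp hz.1.2 hz.2.2, hB, hA, ContinuousLinearMap.smul_comp,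
      ← smul_sub, ContinuousLinearMap.comp_smul]

end KernelDistributionContact
end
end
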